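/- arXiv:1606.01921 — 2 statements merged into one kernel-verified Lean document; each statement's English description precedes it below -/
import Mathlib

section
/- Let L|K be a finite extension of finite extensions of ℚ_p, with rings of integers O_K ⊆ O_L. Then the first André–Quillen homology H₁(L_{O_L/O_K}) of the O_K-algebra O_L vanishes (the cotangent complex of O_L over O_K is acyclic in nonzero degrees). -/
open Polynomial IsLocalRing

/-- A quotient of `R[X]` by an ideal generated by `f`, whose derivative is a nonzerodivisor on
the quotient, has vanishing first André–Quillen homology. -/
theorem Algebra.H1Cotangent.subsingleton_of_ker_aeval_eq_span {R S : Type*} [CommRing R]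
    [CommRing S] [Algebra R S] {x : S} {f : R[X]}
    (hx : Function.Surjective (aeval (R := R) x))
    (hker : RingHom.ker (aeval (R := R) x) = Ideal.span {f})
    (hf : aeval x (derivative f) ∈ nonZeroDivisors S) :
    Subsingleton (Algebra.H1Cotangent R S) := by
  let P := Algebra.Extension.ofSurjective (aeval (R := R) x) hx
  have : Algebra.FormallySmooth R P.Ring := inferInstanceAs (Algebra.FormallySmooth R R[X])
  rw [← P.cotangentComplex_injective_iff, injective_iff_map_eq_zero]
  intro y hy
  obtain ⟨⟨g, hg⟩, rfl⟩ := Algebra.Extension.Cotangent.mk_surjective y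
  rw [Algebra.Extension.cotangentComplex_mk] at hy
  have hg' : g ∈ Ideal.span {f} := hker ▸ hg
  have hfk : f ∈ P.ker := (hker ▸ Ideal.mem_span_singleton_self f :
    f ∈ RingHom.ker (aeval (R := R) x))
  obtain ⟨h : R[X], rfl⟩ := Ideal.mem_span_singleton'.mp hg'
  let _ : Algebra R[X] S := (aeval (R := R) x).toAlgebra
  have hsmul (q : R[X]) (s : S) : q • s = aeval x q * s := rfl
  have : IsScalarTower R R[X] S := .of_algebraMap_eq' (aeval (R := R) x).comp_algebraMap.symm
  let d : Derivation R R[X] S := Polynomial.mkDerivation R (1 : S)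
  have hd := congrArg (LinearMap.liftBaseChange S d.liftKaehlerDifferential) hy
  have hd' : d (h * f) = 0 := by
    have h1 : LinearMap.liftBaseChange S d.liftKaehlerDifferential
        ((1 : S) ⊗ₜ[R[X]] KaehlerDifferential.D R R[X] (h * f : R[X])) = 0 :=
      hd.trans (map_zero _)
    simpa using h1
  have hfx : aeval x f = 0 := hfk
  rw [Polynomial.mkDerivation_apply] at hd'
  have hhx : aeval x h = 0 := by
    apply hf.2
    simpa [hsmul, hfx] using hd'
  rw [Algebra.Extension.Cotangent.mk_eq_zero_iff, pow_two]
  exact Ideal.mul_mem_mul (show h ∈ P.ker from hhx) hfk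

/-- In characteristic zero, monogenic integral extensions of integrally closed domains have
vanishing first André–Quillen homology. -/
theorem Algebra.H1Cotangent.subsingleton_of_adjoin_eq_top {R S : Type*} [CommRing R] [IsDomain R]
    [IsIntegrallyClosed R] [CharZero R] [CommRing S] [IsDomain S] [Algebra R S]
    [Module.IsTorsionFree R S] {x : S} (hx : IsIntegral R x)
    (hadj : Algebra.adjoin R {x} = ⊤) :
    Subsingleton (Algebra.H1Cotangent R S) := by
  refine subsingleton_of_ker_aeval_eq_span (x := x) (f := minpoly R x)
    (IsAdjoinRoot.mkOfAdjoinEqTop hx hadj).map_surjective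
    (IsAdjoinRoot.mkOfAdjoinEqTop hx hadj).ker_map ?_
  refine mem_nonZeroDivisors_of_ne_zero fun h ↦ ?_
  have hdeg := minpoly.natDegree_pos hx
  have hne : derivative (minpoly R x) ≠ 0 := fun h0 ↦
    hdeg.ne' (derivative_eq_zero.mp h0)
  have hle := natDegree_le_of_dvd ((minpoly.isIntegrallyClosed_dvd_iff hx _).mp h) hne
  exact absurd (natDegree_derivative_lt hdeg.ne') hle.not_gt

/-- A finite extension of discrete valuation rings with separable residue field extension is
monogenic. -/
theorem IsDiscreteValuationRing.exists_adjoin_eq_top {A B : Type*} [CommRing A] [IsDomain A]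
    [IsDiscreteValuationRing A] [CommRing B] [IsDomain B] [IsDiscreteValuationRing B]
    [Algebra A B] [Module.Finite A B] [FaithfulSMul A B]
    [Algebra.IsSeparable (ResidueField A) (ResidueField B)] :
    ∃ x : B, Algebra.adjoin A {x} = ⊤ := by
  obtain ⟨a, ha⟩ := Field.exists_primitive_element (ResidueField A) (ResidueField B)
  obtain ⟨f, hf⟩ := Polynomial.map_surjective (residue A) residue_surjective
    (minpoly (ResidueField A) a)
  have hres (g : A[X]) (x : B) : residue B (aeval x g) = aeval (residue B x) (g.map (residue A)) :=
    map_aeval_eq_aeval_map (ψ := residue B) (φ := residue A) rfl g x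
  obtain ⟨x, hxa, hx⟩ : ∃ x : B, residue B x = a ∧ Irreducible (aeval x f) := by
    obtain ⟨x, hxa⟩ := residue_surjective (R := B) a
    obtain ⟨π, hπ⟩ := IsDiscreteValuationRing.exists_irreducible B
    by_cases hx : Irreducible (aeval x f)
    · exact ⟨x, hxa, hx⟩
    refine ⟨x + π, ?_, ?_⟩
    · have : residue B π = 0 := by
        rw [residue_eq_zero_iff, mem_maximalIdeal]; exact hπ.not_isUnit
      rw [map_add, this, add_zero, hxa]
    have hder : IsUnit (aeval x (derivative f)) := by
      rw [← residue_ne_zero_iff_isUnit, hres, ← derivative_map, hf, hxa]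
      exact (Algebra.IsSeparable.isSeparable _ a).aeval_derivative_ne_zero (minpoly.aeval _ _)
    have hfx : π ∣ aeval x f := by
      rw [← Ideal.mem_span_singleton, ← hπ.maximalIdeal_eq, ← residue_eq_zero_iff, hres, hf, hxa,
        minpoly.aeval]
    have hfx2 : π ^ 2 ∣ aeval x f := by
      obtain ⟨c, hc⟩ := hfx
      have : ¬ IsUnit c := fun hu ↦ hx (by
        rw [hc]; exact (irreducible_mul_isUnit hu).mpr hπ)
      obtain ⟨d, rfl⟩ : π ∣ c := by
        rw [← Ideal.mem_span_singleton, ← hπ.maximalIdeal_eq]; exact this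
      exact ⟨d, by rw [hc]; ring⟩
    obtain ⟨c, hc⟩ := hfx2
    obtain ⟨k, hk⟩ := (f.map (algebraMap A B)).binomExpansion x π
    simp only [derivative_map, eval_map_algebraMap] at hk
    have : aeval (x + π) f = π * (aeval x (derivative f) + π * (c + k)) := by
      rw [hk, hc]; ring
    rw [this, irreducible_mul_isUnit]
    · exact hπ
    · rw [← residue_ne_zero_iff_isUnit, map_add, map_mul,
        (residue_eq_zero_iff π).mpr hπ.not_isUnit, zero_mul, add_zero]
      exact (residue_ne_zero_iff_isUnit _).mpr hder
  have hsurj (b : B) : ∃ s ∈ Algebra.adjoin A {x}, aeval x f ∣ b - s := by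
    have htop : Algebra.adjoin (ResidueField A) {a} = ⊤ := by
      rw [← IntermediateField.adjoin_simple_toSubalgebra_of_isAlgebraic
        (Algebra.IsAlgebraic.isAlgebraic a), ha, IntermediateField.top_toSubalgebra]
    rw [Algebra.adjoin_singleton_eq_range_aeval, AlgHom.range_eq_top] at htop
    obtain ⟨q, hq⟩ := htop (residue B b)
    obtain ⟨q, rfl⟩ := Polynomial.map_surjective (residue A) residue_surjective q
    refine ⟨aeval x q, aeval_mem_adjoin_singleton A x, ?_⟩
    rw [← Ideal.mem_span_singleton, ← hx.maximalIdeal_eq, ← residue_eq_zero_iff, map_sub, hres,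
      hxa, hq, sub_self]
  have hpow (n : ℕ) (b : B) : ∃ s ∈ Algebra.adjoin A {x}, aeval x f ^ n ∣ b - s := by
    induction n generalizing b with
    | zero => exact ⟨0, zero_mem _, by simp⟩
    | succ n ih =>
      obtain ⟨s, hs, c, hc⟩ := hsurj b
      obtain ⟨t, ht, d, hd⟩ := ih c
      refine ⟨s + aeval x f * t, add_mem hs (mul_mem (aeval_mem_adjoin_singleton A x) ht), d, ?_⟩
      rw [← sub_sub, hc, ← mul_sub, hd]; ring
  obtain ⟨n, hn⟩ := IsDiscreteValuationRing.ideal_eq_span_pow_irreducible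
    (s := (IsLocalRing.maximalIdeal A).map (algebraMap A B))
    (by
      rw [Ne, Ideal.map_eq_bot_iff_of_injective (FaithfulSMul.algebraMap_injective A B)]
      exact IsDiscreteValuationRing.not_a_field A) hx
  refine ⟨x, eq_top_iff.mpr <| Submodule.le_of_le_smul_of_le_jacobson_bot
      (Module.finite_def.mp inferInstance) (maximalIdeal_le_jacobson ⊥)
      (?_ : ⊤ ≤ (Algebra.adjoin A {x}).toSubmodule ⊔ IsLocalRing.maximalIdeal A • ⊤)⟩
  intro b _
  obtain ⟨s, hs, hb⟩ := hpow n b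
  rw [Ideal.smul_top_eq_map, hn]
  exact Submodule.mem_sup.mpr ⟨s, hs, b - s, Ideal.mem_span_singleton.mpr hb, by ring⟩

/-- Elements of spectral norm at most one are integral over `ℤ_p`. -/
theorem isIntegral_padicInt_of_spectralNorm_le_one {p : ℕ} [Fact p.Prime] {K : Type*} [Field K]
    [Algebra ℚ_[p] K] [FiniteDimensional ℚ_[p] K] [Algebra ℤ_[p] K]
    [IsScalarTower ℤ_[p] ℚ_[p] K] {x : K} (hx : spectralNorm ℚ_[p] K x ≤ 1) :
    IsIntegral ℤ_[p] x := by
  have hmonic := minpoly.monic (Algebra.IsIntegral.isIntegral (R := ℚ_[p]) x)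
  have hlift : minpoly ℚ_[p] x ∈ lifts (algebraMap ℤ_[p] ℚ_[p]) := by
    rw [lifts_iff_coeff_lifts]
    exact fun n ↦ ⟨⟨_, (spectralValue_le_one_iff hmonic).mp hx n⟩, rfl⟩
  obtain ⟨q, hq, -, hqm⟩ := lifts_and_natDegree_eq_and_monic hlift hmonic
  refine ⟨q, hqm, ?_⟩
  rw [← aeval_def, ← aeval_map_algebraMap ℚ_[p], hq, minpoly.aeval]

/-- The ring of integers of a finite extension of `ℚ_p` is local. -/
theorem isLocalRing_of_isIntegralClosure_padicInt (p : ℕ) [Fact p.Prime] (K : Type*) [Field K]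
    [Algebra ℚ_[p] K] [FiniteDimensional ℚ_[p] K] [Algebra ℤ_[p] K]
    [IsScalarTower ℤ_[p] ℚ_[p] K] (O : Type*) [CommRing O] [Algebra ℤ_[p] O] [Algebra O K]
    [IsScalarTower ℤ_[p] O K] [IsIntegralClosure O ℤ_[p] K] : IsLocalRing O := by
  have hinj := IsIntegralClosure.algebraMap_injective O ℤ_[p] K
  have : Nontrivial O := (algebraMap O K).domain_nontrivial
  have hunit (a : O) (ha : 1 ≤ spectralNorm ℚ_[p] K (algebraMap O K a)) : IsUnit a := by
    have ha0 : algebraMap O K a ≠ 0 := fun h ↦ by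
      rw [h, spectralNorm_zero] at ha
      exact absurd ha (by norm_num)
    have hinv : spectralNorm ℚ_[p] K (algebraMap O K a)⁻¹ ≤ 1 := by
      have h := map_inv₀ (spectralMulAlgNorm ℚ_[p] K) (algebraMap O K a)
      simp only [spectralMulAlgNorm_def] at h
      rw [h]
      exact inv_le_one_of_one_le₀ ha
    obtain ⟨b, hb⟩ := IsIntegralClosure.isIntegral_iff (A := O).mp
      (isIntegral_padicInt_of_spectralNorm_le_one hinv)
    refine IsUnit.of_mul_eq_one b (hinj ?_)
    rw [map_mul, hb, map_one, mul_inv_cancel₀ ha0]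
  refine IsLocalRing.of_isUnit_or_isUnit_one_sub_self fun a ↦ ?_
  have h := isNonarchimedean_spectralNorm (K := ℚ_[p]) (algebraMap O K a)
    (algebraMap O K (1 - a))
  rw [← map_add, add_sub_cancel, map_one, spectralNorm_one] at h
  exact (le_max_iff.mp h).imp (hunit a) (hunit _)

/-- A `ℤ_p`-subalgebra of an extension of `ℚ_p` is a faithful `ℤ_p`-algebra. -/
theorem faithfulSMul_padicInt (p : ℕ) [Fact p.Prime] (K : Type*) [Field K]
    [Algebra ℚ_[p] K] [Algebra ℤ_[p] K] [IsScalarTower ℤ_[p] ℚ_[p] K] (O : Type*) [CommRing O]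
    [Algebra ℤ_[p] O] [Algebra O K] [IsScalarTower ℤ_[p] O K] : FaithfulSMul ℤ_[p] O := by
  rw [faithfulSMul_iff_algebraMap_injective]
  refine .of_comp (f := algebraMap O K) ?_
  rw [← RingHom.coe_comp, ← IsScalarTower.algebraMap_eq, IsScalarTower.algebraMap_eq _ ℚ_[p] K]
  exact (algebraMap ℚ_[p] K).injective.comp (IsFractionRing.injective ℤ_[p] ℚ_[p])

/-- The ring of integers of a finite extension of `ℚ_p` is a discrete valuation ring. -/
theorem isDiscreteValuationRing_of_isIntegralClosure_padicInt (p : ℕ) [Fact p.Prime]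
    (K : Type*) [Field K] [Algebra ℚ_[p] K] [FiniteDimensional ℚ_[p] K] [Algebra ℤ_[p] K]
    [IsScalarTower ℤ_[p] ℚ_[p] K] (O : Type*) [CommRing O] [IsDomain O] [Algebra ℤ_[p] O]
    [Algebra O K] [IsScalarTower ℤ_[p] O K] [IsIntegralClosure O ℤ_[p] K] :
    IsDiscreteValuationRing O := by
  have := isLocalRing_of_isIntegralClosure_padicInt p K O
  have := IsIntegralClosure.isDedekindDomain ℤ_[p] ℚ_[p] K O
  have := faithfulSMul_padicInt p K O
  have : Algebra.IsIntegral ℤ_[p] O := IsIntegralClosure.isIntegral_algebra ℤ_[p] K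
  refine ((IsDiscreteValuationRing.TFAE O fun hO ↦ ?_).out 0 2).mpr ‹_›
  exact IsDiscreteValuationRing.not_isField ℤ_[p]
    (isField_of_isIntegral_of_isField (FaithfulSMul.algebraMap_injective ℤ_[p] O) hO)

/-- Let `L|K` be a finite extension of finite extensions of `ℚ_p`,
with rings of integers `O_K ⊆ O_L` (the integral closures of `ℤ_p`).  Then the first
André–Quillen homology `H₁(L_{O_L/O_K})` of the `O_K`-algebra `O_L` vanishes. -/
theorem h1Cotangent_ringOfIntegers_finite_extension_subsingleton
    (p : ℕ) [Fact p.Prime]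
    (K : Type*) [Field K] [Algebra ℚ_[p] K] [FiniteDimensional ℚ_[p] K]
    (L : Type*) [Field L] [Algebra ℚ_[p] L] [FiniteDimensional ℚ_[p] L]
    [Algebra K L] [IsScalarTower ℚ_[p] K L]
    [Algebra ℤ_[p] K] [IsScalarTower ℤ_[p] ℚ_[p] K]
    [Algebra ℤ_[p] L] [IsScalarTower ℤ_[p] ℚ_[p] L]
    (OK : Type*) [CommRing OK] [Algebra ℤ_[p] OK] [Algebra OK K]
    [IsScalarTower ℤ_[p] OK K] [IsIntegralClosure OK ℤ_[p] K]
    (OL : Type*) [CommRing OL] [Algebra ℤ_[p] OL] [Algebra OL L]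
    [IsScalarTower ℤ_[p] OL L] [IsIntegralClosure OL ℤ_[p] L]
    [Algebra OK OL] [Algebra OK L] [IsScalarTower OK K L]
    [IsScalarTower OK OL L] :
    Subsingleton (Algebra.H1Cotangent OK OL) := by
  have : IsDomain OK := (IsIntegralClosure.algebraMap_injective OK ℤ_[p] K).isDomain
  have : IsDomain OL := (IsIntegralClosure.algebraMap_injective OL ℤ_[p] L).isDomain
  have := isDiscreteValuationRing_of_isIntegralClosure_padicInt p K OK
  have := isDiscreteValuationRing_of_isIntegralClosure_padicInt p L OL
  have : CharZero K := charZero_of_injective_algebraMap (algebraMap ℚ_[p] K).injective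
  have : CharZero OK := ⟨fun m n h ↦ by simpa using congrArg (algebraMap OK K) h⟩
  have : FaithfulSMul OK OL := by
    rw [faithfulSMul_iff_algebraMap_injective]
    refine .of_comp (f := algebraMap OL L) ?_
    rw [← RingHom.coe_comp, ← IsScalarTower.algebraMap_eq, IsScalarTower.algebraMap_eq _ K L]
    exact (algebraMap K L).injective.comp (IsIntegralClosure.algebraMap_injective OK ℤ_[p] K)
  have : IsScalarTower ℤ_[p] K L := .to₁₃₄ ℤ_[p] ℚ_[p] K L
  have : IsScalarTower ℤ_[p] OK L := .to₁₂₄ ℤ_[p] OK K L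
  have : IsScalarTower ℤ_[p] OK OL := .of_algebraMap_eq fun a ↦
    IsIntegralClosure.algebraMap_injective OL ℤ_[p] L <| by
      simp only [← IsScalarTower.algebraMap_apply]
  have : Module.Finite ℤ_[p] OK := IsIntegralClosure.finite ℤ_[p] ℚ_[p] K OK
  have : Module.Finite ℤ_[p] OL := IsIntegralClosure.finite ℤ_[p] ℚ_[p] L OL
  have : Module.Finite OK OL := .of_restrictScalars_finite ℤ_[p] OK OL
  have := faithfulSMul_padicInt p K OK
  have : Finite (ResidueField ℤ_[p]) := .of_equiv _ (PadicInt.residueField (p := p)).symm.toEquiv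
  have : Finite (ResidueField OK) := Module.finite_of_finite (ResidueField ℤ_[p])
  obtain ⟨x, hx⟩ := IsDiscreteValuationRing.exists_adjoin_eq_top (A := OK) (B := OL)
  exact Algebra.H1Cotangent.subsingleton_of_adjoin_eq_top (Algebra.IsIntegral.isIntegral x) hx
end

section
/- The first André–Quillen homology H₁(L_{O_K̄/O_K}) of the O_K-algebra O_K̄ vanishes; consequently the cotangent complex of O_K̄ over O_K is quasi-isomorphic to Ω¹_{O_K̄/O_K} placed in degree 0. -/
open MvPolynomial in
/-- The first homology of the naive cotangent complex vanishes iff every relation all of whose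
partial derivatives vanish lies in the square of the ideal of relations. -/
theorem Algebra.Generators.subsingleton_h1Cotangent_iff {R S ι : Type*} [CommRing R] [CommRing S]
    [Algebra R S] (P : Algebra.Generators R S ι) :
    Subsingleton P.toExtension.H1Cotangent ↔
      ∀ f : MvPolynomial ι R, aeval P.val f = 0 → (∀ i, aeval P.val (pderiv i f) = 0) →
        f ∈ RingHom.ker (aeval (R := R) P.val) ^ 2 := by
  have hker : P.toExtension.ker = RingHom.ker (aeval (R := R) P.val) := P.ker_eq_ker_aeval_val
  have hzero (x : P.toExtension.ker) :
      P.toExtension.cotangentComplex (.mk x) = 0 ↔ ∀ i, aeval P.val (pderiv i x.1) = 0 := by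
    rw [← P.cotangentSpaceBasis.repr.map_eq_zero_iff, Finsupp.ext_iff]
    refine forall_congr' fun i => ?_
    rw [Algebra.Extension.cotangentComplex_mk]
    erw [P.cotangentSpaceBasis_repr_one_tmul]
    rfl
  rw [Algebra.Extension.subsingleton_h1Cotangent, injective_iff_map_eq_zero]
  constructor
  · intro h f hf hd
    have hf' : f ∈ P.toExtension.ker := by rw [hker]; exact hf
    have := h (.mk ⟨f, hf'⟩) ((hzero _).2 hd)
    rw [Algebra.Extension.Cotangent.mk_eq_zero_iff] at this
    rwa [← hker]
  · intro h x hx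
    obtain ⟨x, rfl⟩ := Algebra.Extension.Cotangent.mk_surjective x
    rw [Algebra.Extension.Cotangent.mk_eq_zero_iff]
    have := h _ (hker.le x.2) ((hzero _).1 hx)
    rwa [← hker] at this

open MvPolynomial in
/-- If every finite subset of `C` lies in a subalgebra with vanishing `H₁` of the cotangent
complex, then so does `C`. -/
theorem Algebra.subsingleton_h1Cotangent_of_forall_finset {A C : Type*} [CommRing A] [CommRing C]
    [Algebra A C]
    (h : ∀ s : Finset C, ∃ B : Subalgebra A C, (s : Set C) ⊆ B ∧
      Subsingleton (Algebra.H1Cotangent A B)) :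
    Subsingleton (Algebra.H1Cotangent A C) := by
  classical
  rw [Algebra.Generators.subsingleton_h1Cotangent_iff]
  intro f hf hd
  obtain ⟨B, hB, hsub⟩ := h f.vars
  rw [Algebra.Generators.subsingleton_h1Cotangent_iff] at hsub
  have hinj : Function.Injective ((↑) : B → C) := Subtype.val_injective
  have hval (q : MvPolynomial B A) : aeval (Algebra.Generators.self A C).val
      (rename ((↑) : B → C) q) = (aeval (Algebra.Generators.self A B).val q : C) := by
    rw [aeval_rename, ← Subalgebra.coe_val, ← AlgHom.comp_apply, comp_aeval]
    rfl
  obtain ⟨g, rfl⟩ := exists_rename_eq_of_vars_subset_range f ((↑) : B → C) hinj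
    (by simpa using hB)
  have hg := hsub g (hinj (by rw [← hval]; simpa using hf)) fun i =>
    hinj (by rw [← hval, ← pderiv_rename hinj]; simpa using hd i)
  have hle : RingHom.ker (aeval (R := A) (Algebra.Generators.self A B).val) ≤
      (RingHom.ker (aeval (R := A) (Algebra.Generators.self A C).val)).comap
        (rename ((↑) : B → C)) := by
    intro q hq
    rw [RingHom.mem_ker] at hq
    rw [Ideal.mem_comap, RingHom.mem_ker, hval, hq, ZeroMemClass.coe_zero]
  exact Ideal.le_comap_pow _ 2 (Ideal.pow_right_mono hle 2 hg)

/-- A monogenic algebra `A[X]/(g)` with `g'` nonvanishing at the generator has vanishing `H₁`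
of the cotangent complex. -/
theorem Algebra.subsingleton_h1Cotangent_of_adjoin_eq_top {A B : Type*} [CommRing A] [CommRing B]
    [IsDomain B] [Algebra A B] {α : B} (hα : Algebra.adjoin A {α} = ⊤) {g : Polynomial A}
    (hg : ∀ f : Polynomial A, Polynomial.aeval α f = 0 ↔ g ∣ f)
    (hg' : Polynomial.aeval α g.derivative ≠ 0) :
    Subsingleton (Algebra.H1Cotangent A B) := by
  have hsurj : Function.Surjective
      (MvPolynomial.aeval (R := A) (fun _ : Unit => α)) := by
    rw [← AlgHom.range_eq_top, ← Algebra.adjoin_range_eq_range_aeval, Set.range_const, hα]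
  let P := Algebra.Generators.ofSurjective (R := A) (fun _ : Unit => α) hsurj
  refine ((Algebra.Generators.H1Cotangent.equiv (Algebra.Generators.self A B)
    P).toEquiv.subsingleton_congr).2 ?_
  rw [Algebra.Generators.subsingleton_h1Cotangent_iff]
  intro f hf hd
  change MvPolynomial.aeval (fun _ : Unit => α) f = 0 at hf
  replace hd : MvPolynomial.aeval (fun _ : Unit => α) (MvPolynomial.pderiv () f) = 0 := hd ()
  change f ∈ RingHom.ker (MvPolynomial.aeval (R := A) (fun _ : Unit => α)) ^ 2
  let φ : Polynomial A →ₐ[A] MvPolynomial Unit A := Polynomial.aeval (MvPolynomial.X ())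
  have hφ (q : Polynomial A) :
      MvPolynomial.aeval (fun _ : Unit => α) (φ q) = Polynomial.aeval α q := by
    simp [φ, ← Polynomial.aeval_algHom_apply]
  obtain ⟨F, rfl⟩ : ∃ F, φ F = f :=
    ⟨MvPolynomial.uniqueAlgEquiv A Unit f,
      (MvPolynomial.uniqueAlgEquiv A Unit).symm_apply_apply f⟩
  have hgα : Polynomial.aeval α g = 0 := (hg g).2 dvd_rfl
  obtain ⟨q, rfl⟩ := (hg F).1 (by rw [← hφ, hf])
  have hq : Polynomial.aeval α q = 0 := by
    rw [Derivation.map_aeval, MvPolynomial.pderiv_X_self, smul_eq_mul, mul_one] at hd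
    change MvPolynomial.aeval _ (φ _) = 0 at hd
    rw [hφ, Polynomial.derivative_mul] at hd
    simpa [hgα, hg'] using hd
  rw [map_mul, pow_two]
  exact Ideal.mul_mem_mul ((hφ g).trans hgα) ((hφ q).trans hq)

theorem Algebra.subsingleton_h1Cotangent_of_adjoin_eq_top_of_charZero {A B : Type*} [CommRing A]
    [CommRing B] [IsDomain A] [IsIntegrallyClosed A] [CharZero A] [IsDomain B] [Algebra A B]
    [FaithfulSMul A B] {α : B} (hint : IsIntegral A α) (hα : Algebra.adjoin A {α} = ⊤) :
    Subsingleton (Algebra.H1Cotangent A B) := by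
  refine Algebra.subsingleton_h1Cotangent_of_adjoin_eq_top hα (g := minpoly A α)
    (fun f => minpoly.isIntegrallyClosed_dvd_iff hint f) fun h => ?_
  rw [minpoly.isIntegrallyClosed_dvd_iff hint] at h
  have hpos := minpoly.natDegree_pos hint
  have hd := Polynomial.eq_zero_of_dvd_of_natDegree_lt h
    (Polynomial.natDegree_derivative_lt hpos.ne')
  exact hpos.ne' (Polynomial.derivative_eq_zero.1 hd)

open IsLocalRing Polynomial in
/-- A finite local extension of a local ring with finite residue field by a discrete valuation
ring is monogenic. -/
theorem Algebra.exists_adjoin_singleton_eq_top_of_isDiscreteValuationRing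
    {A B : Type*} [CommRing A] [CommRing B]
    [IsDomain B] [Algebra A B] [IsLocalRing A] [IsDiscreteValuationRing B] [Module.Finite A B]
    [IsLocalHom (algebraMap A B)] [Finite (ResidueField A)]
    (hA : (maximalIdeal A).map (algebraMap A B) ≠ ⊥) :
    ∃ α : B, Algebra.adjoin A {α} = ⊤ := by
  obtain ⟨β₀, hβ₀⟩ := Field.exists_primitive_element (ResidueField A) (ResidueField B)
  have hgen : Function.Surjective (aeval (R := ResidueField A) β₀) := by
    rw [← AlgHom.range_eq_top, ← Algebra.adjoin_singleton_eq_range_aeval,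
      ← IntermediateField.adjoin_simple_toSubalgebra_of_isAlgebraic
        (Algebra.IsAlgebraic.isAlgebraic β₀),
      hβ₀, IntermediateField.top_toSubalgebra]
  have hmap (q : A[X]) (b : B) :
      residue B (aeval b q) = aeval (residue B b) (q.map (residue A)) :=
    (map_aeval_eq_aeval_map (ψ := residue B) (φ := residue A) rfl q b)
  obtain ⟨f, hf⟩ := Polynomial.map_surjective _ (residue_surjective (R := A))
    (minpoly (ResidueField A) β₀)
  obtain ⟨ϖ, hϖ⟩ := IsDiscreteValuationRing.exists_irreducible B
  have hmax := hϖ.maximalIdeal_eq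
  have hϖmem : ϖ ∈ maximalIdeal B := by rw [hmax]; exact Ideal.mem_span_singleton_self _
  obtain ⟨α, hα, hirr⟩ : ∃ α : B, residue B α = β₀ ∧ Irreducible (aeval α f) := by
    obtain ⟨β, hβ⟩ := residue_surjective (R := B) β₀
    have hmem : aeval β f ∈ maximalIdeal B := by
      rw [← residue_eq_zero_iff, hmap, hβ, hf, minpoly.aeval]
    have hder : aeval β (derivative f) ∉ maximalIdeal B := by
      rw [← residue_eq_zero_iff, hmap, hβ, ← derivative_map, hf]
      exact (Algebra.IsSeparable.isSeparable (ResidueField A) β₀).aeval_derivative_ne_zero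
        (minpoly.aeval _ _)
    have hunit {c : B} (hc : c ∉ maximalIdeal B) : Irreducible (ϖ * c) :=
      (irreducible_mul_isUnit (by simpa using hc)).2 hϖ
    obtain ⟨c, hc⟩ := Ideal.mem_span_singleton.1 (hmax ▸ hmem)
    by_cases hcm : c ∈ maximalIdeal B
    · refine ⟨β + ϖ, by rw [map_add, hβ, (residue_eq_zero_iff _).2 hϖmem, add_zero], ?_⟩
      obtain ⟨k, hk⟩ := (f.map (algebraMap A B)).binomExpansion β ϖ
      rw [derivative_map] at hk
      simp only [eval_map_algebraMap] at hk
      rw [hk, hc, show ϖ * c + aeval β (derivative f) * ϖ + k * ϖ ^ 2 =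
        ϖ * (aeval β (derivative f) + (c + k * ϖ)) by ring]
      refine hunit fun h => hder ?_
      exact (Ideal.add_mem_iff_left _
        (Ideal.add_mem _ hcm (Ideal.mul_mem_left _ _ hϖmem))).1 h
    · exact ⟨β, hβ, hc ▸ hunit hcm⟩
  refine ⟨α, ?_⟩
  set S := Algebra.adjoin A {α}
  have hS (q : A[X]) : aeval α q ∈ S := aeval_mem_adjoin_singleton A α
  have happrox (n : ℕ) (b : B) : ∃ s ∈ S, ∃ c, b = s + aeval α f ^ n * c := by
    induction n generalizing b with
    | zero => exact ⟨0, S.zero_mem, b, by simp⟩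
    | succ n ih =>
      obtain ⟨q₀, hq₀⟩ := hgen (residue B b)
      obtain ⟨q, rfl⟩ := Polynomial.map_surjective _ (residue_surjective (R := A)) q₀
      have : b - aeval α q ∈ maximalIdeal B := by
        rw [← residue_eq_zero_iff, map_sub, hmap, hα, hq₀, sub_self]
      rw [hirr.maximalIdeal_eq, Ideal.mem_span_singleton] at this
      obtain ⟨c, hc⟩ := this
      obtain ⟨s, hs, d, rfl⟩ := ih c
      exact ⟨aeval α q + aeval α f * s, S.add_mem (hS q) (S.mul_mem (hS f) hs), d,
        by linear_combination hc⟩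
  obtain ⟨e, he⟩ := IsDiscreteValuationRing.ideal_eq_span_pow_irreducible hA hirr
  refine _root_.eq_top_iff.mpr <| Submodule.le_of_le_smul_of_le_jacobson_bot
    (Module.finite_def.mp inferInstance) (IsLocalRing.maximalIdeal_le_jacobson ⊥)
    (?_ : ⊤ ≤ S.toSubmodule ⊔ maximalIdeal A • ⊤)
  intro b _
  obtain ⟨s, hs, c, rfl⟩ := happrox e b
  rw [Ideal.smul_top_eq_map, he]
  exact Submodule.add_mem_sup hs (Ideal.mul_mem_right _ _ (Ideal.mem_span_singleton_self _))

section
variable (p : ℕ) [Fact p.Prime] {L : Type*} [Field L] [Algebra ℚ_[p] L] [Algebra ℤ_[p] L]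
    [IsScalarTower ℤ_[p] ℚ_[p] L]

theorem PadicInt.isIntegral_of_spectralNorm_le_one [Algebra.IsAlgebraic ℚ_[p] L] {x : L}
    (hx : spectralNorm ℚ_[p] L x ≤ 1) : IsIntegral ℤ_[p] x := by
  have hmonic := minpoly.monic (Algebra.IsIntegral.isIntegral (R := ℚ_[p]) x)
  have hcoeff := (spectralValue_le_one_iff hmonic).1 hx
  have hlift : minpoly ℚ_[p] x ∈ Polynomial.lifts (algebraMap ℤ_[p] ℚ_[p]) := by
    rw [Polynomial.lifts_iff_coeff_lifts]
    exact fun n => ⟨⟨_, hcoeff n⟩, rfl⟩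
  obtain ⟨q, hq, -, hqm⟩ := Polynomial.lifts_and_natDegree_eq_and_monic hlift hmonic
  refine ⟨q, hqm, ?_⟩
  rw [← Polynomial.aeval_def, ← Polynomial.aeval_map_algebraMap ℚ_[p], hq, minpoly.aeval]

theorem PadicInt.isIntegral_or_isIntegral_inv [Algebra.IsAlgebraic ℚ_[p] L] (x : L) :
    IsIntegral ℤ_[p] x ∨ IsIntegral ℤ_[p] x⁻¹ := by
  by_cases hx : spectralNorm ℚ_[p] L x ≤ 1
  · exact .inl (PadicInt.isIntegral_of_spectralNorm_le_one p hx)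
  · right
    apply PadicInt.isIntegral_of_spectralNorm_le_one p
    have h0 : x ≠ 0 := by
      rintro rfl
      exact hx (by simp [spectralNorm_zero])
    have hmul := map_mul (spectralMulAlgNorm ℚ_[p] L) x x⁻¹
    rw [mul_inv_cancel₀ h0, map_one, spectralMulAlgNorm_def, spectralMulAlgNorm_def] at hmul
    nlinarith [spectralNorm_nonneg (K := ℚ_[p]) (L := L) x⁻¹]

theorem PadicInt.isDiscreteValuationRing_of_isIntegralClosure [FiniteDimensional ℚ_[p] L]
    (B : Type*) [CommRing B] [IsDomain B] [Algebra ℤ_[p] B] [Algebra B L]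
    [IsScalarTower ℤ_[p] B L] [IsIntegralClosure B ℤ_[p] L] : IsDiscreteValuationRing B := by
  have : IsFractionRing B L :=
    IsIntegralClosure.isFractionRing_of_finite_extension ℤ_[p] ℚ_[p] L B
  have : IsNoetherianRing B := IsIntegralClosure.isNoetherianRing ℤ_[p] ℚ_[p] L B
  have : ValuationRing B := by
    rw [ValuationRing.iff_isInteger_or_isInteger B L]
    intro x
    exact (PadicInt.isIntegral_or_isIntegral_inv p x).imp
      (IsIntegralClosure.isIntegral_iff (A := B)).1 (IsIntegralClosure.isIntegral_iff (A := B)).1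
  have hfield : ¬ IsField B := by
    have : Algebra.IsIntegral ℤ_[p] B := IsIntegralClosure.isIntegral_algebra ℤ_[p] L
    have hinj : Function.Injective (algebraMap ℤ_[p] B) := by
      have : Function.Injective (algebraMap ℤ_[p] L) := by
        rw [IsScalarTower.algebraMap_eq ℤ_[p] ℚ_[p] L]
        exact (algebraMap ℚ_[p] L).injective.comp (IsFractionRing.injective ℤ_[p] ℚ_[p])
      rw [IsScalarTower.algebraMap_eq ℤ_[p] B L, RingHom.coe_comp] at this
      exact this.of_comp
    intro h
    exact IsDiscreteValuationRing.not_isField ℤ_[p] (isField_of_isIntegral_of_isField hinj h)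
  exact ((IsDiscreteValuationRing.TFAE B hfield).out 0 1).2 this
end

/-- Let `K ⊆ L` be finite extensions of `ℚ_[p]` with rings of integers `A ⊆ B`. The first homology
of the cotangent complex of `B` over `A` vanishes. -/
theorem PadicInt.subsingleton_h1Cotangent_of_isIntegralClosure (p : ℕ) [Fact p.Prime]
    (K L : Type*) [Field K] [Algebra ℚ_[p] K] [FiniteDimensional ℚ_[p] K]
    [Algebra ℤ_[p] K] [IsScalarTower ℤ_[p] ℚ_[p] K]
    [Field L] [Algebra ℚ_[p] L] [FiniteDimensional ℚ_[p] L]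
    [Algebra ℤ_[p] L] [IsScalarTower ℤ_[p] ℚ_[p] L]
    (A B : Type*) [CommRing A] [Algebra ℤ_[p] A] [Algebra A K]
    [IsScalarTower ℤ_[p] A K] [IsIntegralClosure A ℤ_[p] K]
    [CommRing B] [Algebra ℤ_[p] B] [Algebra B L]
    [IsScalarTower ℤ_[p] B L] [IsIntegralClosure B ℤ_[p] L]
    [Algebra A B] [IsScalarTower ℤ_[p] A B] [FaithfulSMul A B] :
    Subsingleton (Algebra.H1Cotangent A B) := by
  have : IsDomain A := (IsIntegralClosure.algebraMap_injective A ℤ_[p] K).isDomain (algebraMap A K)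
  have : IsDomain B := (IsIntegralClosure.algebraMap_injective B ℤ_[p] L).isDomain (algebraMap B L)
  have : IsDiscreteValuationRing A :=
    PadicInt.isDiscreteValuationRing_of_isIntegralClosure p (L := K) A
  have : IsDiscreteValuationRing B :=
    PadicInt.isDiscreteValuationRing_of_isIntegralClosure p (L := L) B
  have : Module.Finite ℤ_[p] A := IsIntegralClosure.finite ℤ_[p] ℚ_[p] K A
  have : Module.Finite ℤ_[p] B := IsIntegralClosure.finite ℤ_[p] ℚ_[p] L B
  have : Module.Finite A B := Module.Finite.of_restrictScalars_finite ℤ_[p] A B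
  have hinj : Function.Injective (algebraMap ℤ_[p] A) := by
    have : Function.Injective (algebraMap ℤ_[p] K) := by
      rw [IsScalarTower.algebraMap_eq ℤ_[p] ℚ_[p] K]
      exact (algebraMap ℚ_[p] K).injective.comp (IsFractionRing.injective ℤ_[p] ℚ_[p])
    rw [IsScalarTower.algebraMap_eq ℤ_[p] A K, RingHom.coe_comp] at this
    exact this.of_comp
  have : FaithfulSMul ℤ_[p] A := (faithfulSMul_iff_algebraMap_injective _ _).2 hinj
  have : CharZero A := charZero_of_injective_algebraMap hinj
  have : Finite (IsLocalRing.ResidueField ℤ_[p]) :=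
    Finite.of_equiv _ (PadicInt.residueField (p := p)).symm.toEquiv
  have : Finite (IsLocalRing.ResidueField A) :=
    IsLocalRing.ResidueField.finite_of_finite (R := ℤ_[p]) this
  obtain ⟨α, hα⟩ := Algebra.exists_adjoin_singleton_eq_top_of_isDiscreteValuationRing
    (A := A) (B := B) <| by
      rw [Ne, Ideal.map_eq_bot_iff_of_injective (FaithfulSMul.algebraMap_injective A B)]
      exact IsDiscreteValuationRing.not_a_field A
  exact Algebra.subsingleton_h1Cotangent_of_adjoin_eq_top_of_charZero
    (Algebra.IsIntegral.isIntegral α) hα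

/-- Let `p` be a prime, `K` a finite extension of `ℚ_p` with ring of
integers `O_K`, and `O_K̄` the ring of integers of an algebraic closure `K̄` of `K`.
Then the first André–Quillen homology `H₁(L_{O_K̄/O_K})` of the `O_K`-algebra `O_K̄`
vanishes (so the cotangent complex of `O_K̄` over `O_K` is quasi-isomorphic to
`Ω¹_{O_K̄/O_K}` placed in degree `0`). -/
theorem h1Cotangent_ringOfIntegers_algebraicClosure_subsingleton
    (p : ℕ) [Fact p.Prime]
    (K : Type*) [Field K] [Algebra ℚ_[p] K] [FiniteDimensional ℚ_[p] K]
    (Kbar : Type*) [Field Kbar] [Algebra K Kbar] [IsAlgClosure K Kbar]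
    [Algebra ℤ_[p] K] [IsScalarTower ℤ_[p] ℚ_[p] K]
    [Algebra ℚ_[p] Kbar] [Algebra ℤ_[p] Kbar]
    [IsScalarTower ℤ_[p] ℚ_[p] Kbar] [IsScalarTower ℚ_[p] K Kbar]
    (OK : Type*) [CommRing OK] [Algebra ℤ_[p] OK] [Algebra OK K]
    [IsScalarTower ℤ_[p] OK K] [IsIntegralClosure OK ℤ_[p] K]
    (OKbar : Type*) [CommRing OKbar] [Algebra ℤ_[p] OKbar] [Algebra OKbar Kbar]
    [IsScalarTower ℤ_[p] OKbar Kbar] [IsIntegralClosure OKbar ℤ_[p] Kbar]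
    [Algebra OK OKbar] [Algebra OK Kbar] [IsScalarTower OK K Kbar]
    [IsScalarTower OK OKbar Kbar] :
    Subsingleton (Algebra.H1Cotangent OK OKbar) := by
  have hinjbar : Function.Injective (algebraMap OKbar Kbar) :=
    IsIntegralClosure.algebraMap_injective OKbar ℤ_[p] Kbar
  have : IsScalarTower ℤ_[p] K Kbar := .of_algebraMap_eq fun x => by
    rw [IsScalarTower.algebraMap_apply ℤ_[p] ℚ_[p] Kbar,
      IsScalarTower.algebraMap_apply ℚ_[p] K Kbar,
      ← IsScalarTower.algebraMap_apply ℤ_[p] ℚ_[p] K]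
  have : IsScalarTower ℤ_[p] OK OKbar := .of_algebraMap_eq fun x => hinjbar <| by
    rw [← IsScalarTower.algebraMap_apply OK OKbar Kbar,
      ← IsScalarTower.algebraMap_apply ℤ_[p] OKbar Kbar,
      IsScalarTower.algebraMap_apply OK K Kbar, ← IsScalarTower.algebraMap_apply ℤ_[p] OK K,
      ← IsScalarTower.algebraMap_apply ℤ_[p] K Kbar]
  have hinj : Function.Injective (algebraMap OK OKbar) := by
    have : Function.Injective (algebraMap OK Kbar) := by
      rw [IsScalarTower.algebraMap_eq OK K Kbar]
      exact (algebraMap K Kbar).injective.comp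
        (IsIntegralClosure.algebraMap_injective OK ℤ_[p] K)
    rw [IsScalarTower.algebraMap_eq OK OKbar Kbar, RingHom.coe_comp] at this
    exact this.of_comp
  have : Algebra.IsAlgebraic K Kbar := IsAlgClosure.isAlgebraic
  refine Algebra.subsingleton_h1Cotangent_of_forall_finset fun s => ?_
  let L : IntermediateField K Kbar :=
    IntermediateField.adjoin K (algebraMap OKbar Kbar '' (s : Set OKbar))
  have : FiniteDimensional K L := by
    have : Finite (algebraMap OKbar Kbar '' (s : Set OKbar)) := (s.finite_toSet.image _).to_subtype
    exact IntermediateField.finiteDimensional_adjoin fun x _ => Algebra.IsIntegral.isIntegral x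
  have : FiniteDimensional ℚ_[p] L := FiniteDimensional.trans ℚ_[p] K L
  let B : Subalgebra OK OKbar :=
    (L.toSubalgebra.restrictScalars OK).comap (IsScalarTower.toAlgHom OK OKbar Kbar)
  refine ⟨B, fun x hx => IntermediateField.subset_adjoin K _ (Set.mem_image_of_mem _ hx), ?_⟩
  let φ : B →+* L := ((algebraMap OKbar Kbar).comp B.subtype).codRestrict L fun x => x.2
  let : Algebra B L := φ.toAlgebra
  have : IsScalarTower ℤ_[p] L Kbar := .of_algebraMap_eq fun _ => rfl
  have : IsScalarTower ℤ_[p] ℚ_[p] L := .of_algebraMap_eq fun x => Subtype.ext <|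
    IsScalarTower.algebraMap_apply ℤ_[p] ℚ_[p] Kbar x
  have : IsScalarTower ℤ_[p] B L := .of_algebraMap_eq fun x => Subtype.ext <|
    IsScalarTower.algebraMap_apply ℤ_[p] OKbar Kbar x
  have : IsIntegralClosure B ℤ_[p] L :=
    { algebraMap_injective := fun x y h => Subtype.ext (hinjbar (congrArg Subtype.val h))
      isIntegral_iff := fun {x} => by
        rw [← isIntegral_algebraMap_iff (algebraMap L Kbar).injective,
          IsIntegralClosure.isIntegral_iff (A := OKbar)]
        constructor
        · rintro ⟨y, hy⟩
          exact ⟨⟨y, show algebraMap OKbar Kbar y ∈ L from hy ▸ x.2⟩, Subtype.ext hy⟩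
        · rintro ⟨y, rfl⟩
          exact ⟨y, rfl⟩ }
  have : FaithfulSMul OK B := (faithfulSMul_iff_algebraMap_injective _ _).2 fun x y h =>
    hinj (congrArg Subtype.val h)
  exact PadicInt.subsingleton_h1Cotangent_of_isIntegralClosure p K L OK B
end
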